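/- Let f : ℝ^p → ℝⁿ be continuously differentiable, Y ∈ ℝⁿ, η > 0, and let Θ : [0,∞) → ℝ^p be differentiable with Θ'(t) = −η ∇L(Θ(t)) for all t ≥ 0, where L(Θ) = ½‖f(Θ) − Y‖₂². Write R = ‖f(Θ(0)) − Y‖₂, let Df(Θ) denote the n × p Jacobian of f at Θ, and let K̂(Θ) = Df(Θ) Df(Θ)ᵀ. Suppose there are λ > 0 and κ ≥ 0 such that for every t ≥ 0: (a) vᵀ K̂(Θ(t)) v ≥ λ‖v‖₂² for all v ∈ ℝⁿ, and (b) ‖K̂(Θ(t)) − K̂(Θ(0))‖_op ≤ κ. Let F^lin : [0,∞) → ℝⁿ be differentiable with F^lin(0) = f(Θ(0)) and (F^lin)'(t) = −η K̂(Θ(0)) (F^lin(t) − Y). Then ‖f(Θ(t)) − F^lin(t)‖₂ ≤ (κ R / λ)(1 − e^{−ηλt}) for all t ≥ 0. -/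

import Mathlib

open Matrix

/-- Operator norm of a real matrix viewed as a linear map between Euclidean spaces. -/
noncomputable def matOpNorm {m n : Type*} [Fintype m] [Fintype n] [DecidableEq n]
    (A : Matrix m n ℝ) : ℝ :=
  ‖LinearMap.toContinuousLinearMap (Matrix.toEuclideanLin A)‖

/-- The Jacobian matrix of `f : ℝ^p → ℝ^n` at `Θ`. -/
noncomputable def jacobian {p n : ℕ}
    (f : EuclideanSpace ℝ (Fin p) → EuclideanSpace ℝ (Fin n))
    (Θ : EuclideanSpace ℝ (Fin p)) : Matrix (Fin n) (Fin p) ℝ :=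
  fun i j => fderiv ℝ f Θ (EuclideanSpace.single j 1) i

open scoped InnerProductSpace

section Growth

variable {E : Type*} [NormedAddCommGroup E] [InnerProductSpace ℝ E]

/-- If `⟪g, g'⟫ ≤ b ‖g‖`, then `‖g‖` grows at most linearly with slope `b`. -/
theorem norm_le_add_mul_of_inner_deriv_le {g g' : ℝ → E} {b : ℝ} (hb : 0 ≤ b)
    (hg : ∀ t, 0 ≤ t → HasDerivAt g (g' t) t)
    (hinner : ∀ t, 0 ≤ t → ⟪g t, g' t⟫_ℝ ≤ b * ‖g t‖) {t : ℝ} (ht : 0 ≤ t) :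
    ‖g t‖ ≤ ‖g 0‖ + b * t := by
  refine le_of_forall_pos_le_add fun ε hε => ?_
  have hpos : ∀ s, 0 < ‖g s‖ ^ 2 + ε ^ 2 := fun s => by positivity
  have hderiv : ∀ s, 0 ≤ s → HasDerivAt (fun s => √(‖g s‖ ^ 2 + ε ^ 2) - b * s)
      (2 * ⟪g s, g' s⟫_ℝ / (2 * √(‖g s‖ ^ 2 + ε ^ 2)) - b * 1) s := fun s hs =>
    (((hg s hs).norm_sq.add_const _).sqrt (hpos s).ne').sub ((hasDerivAt_id s).const_mul b)
  have hanti : AntitoneOn (fun s => √(‖g s‖ ^ 2 + ε ^ 2) - b * s) (Set.Ici 0) := by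
    refine antitoneOn_of_deriv_nonpos (convex_Ici 0)
      (fun s hs => (hderiv s hs).continuousAt.continuousWithinAt)
      (fun s hs => (hderiv s (interior_subset hs)).differentiableAt.differentiableWithinAt)
      fun s hs => ?_
    have hs : 0 ≤ s := interior_subset hs
    rw [(hderiv s hs).deriv, mul_div_mul_left _ _ two_ne_zero, mul_one, sub_nonpos,
      div_le_iff₀ (Real.sqrt_pos.2 (hpos s))]
    refine (hinner s hs).trans (mul_le_mul_of_nonneg_left (Real.le_sqrt_of_sq_le ?_) hb)
    linarith [sq_nonneg ε]
  have hle := hanti Set.self_mem_Ici ht ht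
  have hstart : √(‖g 0‖ ^ 2 + ε ^ 2) ≤ ‖g 0‖ + ε :=
    Real.sqrt_le_iff.2 ⟨by positivity, by nlinarith [mul_nonneg (norm_nonneg (g 0)) hε.le]⟩
  have hend : ‖g t‖ ≤ √(‖g t‖ ^ 2 + ε ^ 2) :=
    Real.le_sqrt_of_sq_le (by linarith [sq_nonneg ε])
  simp only [mul_zero, sub_zero] at hle
  linarith

/-- A Grönwall estimate for a dissipative equation with an exponentially decaying source. -/
theorem norm_le_mul_exp_of_inner_deriv_le {g g' : ℝ → E} {b c : ℝ} (hb : 0 ≤ b)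
    (hg : ∀ t, 0 ≤ t → HasDerivAt g (g' t) t)
    (hinner : ∀ t, 0 ≤ t →
      ⟪g t, g' t⟫_ℝ ≤ -c * ‖g t‖ ^ 2 + b * Real.exp (-c * t) * ‖g t‖) {t : ℝ} (ht : 0 ≤ t) :
    ‖g t‖ ≤ (‖g 0‖ + b * t) * Real.exp (-c * t) := by
  have hexp : ∀ s, HasDerivAt (fun s => Real.exp (c * s)) (Real.exp (c * s) * (c * 1)) s :=
    fun s => ((hasDerivAt_id s).const_mul c).exp
  have hnorm : ∀ s, ‖Real.exp (c * s) • g s‖ = Real.exp (c * s) * ‖g s‖ := fun s => by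
    rw [norm_smul, Real.norm_of_nonneg (Real.exp_pos _).le]
  have hcancel : ∀ s, Real.exp (c * s) * Real.exp (-c * s) = 1 := fun s => by
    rw [← Real.exp_add]; simp
  have key := norm_le_add_mul_of_inner_deriv_le hb
    (fun s hs => (hexp s).smul (hg s hs)) (fun s hs => ?_) ht
  · simp only [Pi.smul_apply', hnorm, mul_zero, Real.exp_zero, one_smul] at key
    calc ‖g t‖ = Real.exp (c * t) * ‖g t‖ * Real.exp (-c * t) := by
          linear_combination -‖g t‖ * hcancel t
      _ ≤ _ := mul_le_mul_of_nonneg_right key (Real.exp_pos _).le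
  · simp only [Pi.smul_apply', hnorm, inner_add_right, real_inner_smul_left, real_inner_smul_right,
      real_inner_self_eq_norm_sq]
    calc _ = Real.exp (c * s) ^ 2 * (⟪g s, g' s⟫_ℝ + c * ‖g s‖ ^ 2) := by ring
      _ ≤ Real.exp (c * s) ^ 2 * (b * Real.exp (-c * s) * ‖g s‖) := by
          gcongr; linarith [hinner s hs]
      _ = _ := by linear_combination b * Real.exp (c * s) * ‖g s‖ * hcancel s

end Growth

theorem toEuclideanLin_jacobian {p n : ℕ}
    (f : EuclideanSpace ℝ (Fin p) → EuclideanSpace ℝ (Fin n)) (Θ : EuclideanSpace ℝ (Fin p)) :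
    Matrix.toEuclideanLin (jacobian f Θ) = (fderiv ℝ f Θ : _ →ₗ[ℝ] _) := by
  refine (EuclideanSpace.basisFun (Fin p) ℝ).toBasis.ext fun j => ?_
  ext i
  simp [Matrix.toLpLin_apply, jacobian]

theorem toEuclideanLin_jacobian_mul_transpose {p n : ℕ}
    (f : EuclideanSpace ℝ (Fin p) → EuclideanSpace ℝ (Fin n)) (Θ : EuclideanSpace ℝ (Fin p))
    (v : EuclideanSpace ℝ (Fin n)) :
    Matrix.toEuclideanLin (jacobian f Θ * (jacobian f Θ)ᵀ) v =
      fderiv ℝ f Θ (ContinuousLinearMap.adjoint (fderiv ℝ f Θ) v) := by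
  have hadj : Matrix.toEuclideanLin (jacobian f Θ)ᵀ v =
      ContinuousLinearMap.adjoint (fderiv ℝ f Θ) v := by
    refine ext_inner_right ℝ fun w => ?_
    rw [ContinuousLinearMap.adjoint_inner_left, ← Matrix.conjTranspose_eq_transpose_of_trivial,
      Matrix.toEuclideanLin_conjTranspose_eq_adjoint, LinearMap.adjoint_inner_left,
      toEuclideanLin_jacobian]
    rfl
  rw [← hadj, ← ContinuousLinearMap.coe_coe, ← toEuclideanLin_jacobian]
  simp [Matrix.toLpLin_apply, Matrix.mulVec_mulVec]

theorem norm_toEuclideanLin_le_matOpNorm {m n : Type*} [Fintype m] [Fintype n] [DecidableEq n]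
    (A : Matrix m n ℝ) (v : EuclideanSpace ℝ n) :
    ‖Matrix.toEuclideanLin A v‖ ≤ matOpNorm A * ‖v‖ :=
  (LinearMap.toContinuousLinearMap (Matrix.toEuclideanLin A)).le_opNorm v

theorem inner_toEuclideanLin {n : ℕ} (A : Matrix (Fin n) (Fin n) ℝ)
    (v : EuclideanSpace ℝ (Fin n)) :
    ⟪v, Matrix.toEuclideanLin A v⟫_ℝ = (fun i => v i) ⬝ᵥ (A *ᵥ fun i => v i) := by
  rw [EuclideanSpace.inner_eq_star_dotProduct, dotProduct_comm]
  rfl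

theorem hasGradientAt_half_norm_sub_sq {E F : Type*}
    [NormedAddCommGroup E] [InnerProductSpace ℝ E] [CompleteSpace E]
    [NormedAddCommGroup F] [InnerProductSpace ℝ F] [CompleteSpace F]
    {f : E → F} {x : E} (hf : DifferentiableAt ℝ f x) (y : F) :
    HasGradientAt (fun x => (1 / 2) * ‖f x - y‖ ^ 2)
      (ContinuousLinearMap.adjoint (fderiv ℝ f x) (f x - y)) x := by
  rw [hasGradientAt_iff_hasFDerivAt]
  refine ((hf.hasFDerivAt.sub_const y).norm_sq.const_mul (1 / 2)).congr_fderiv ?_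
  ext w
  simp [ContinuousLinearMap.adjoint_inner_left]

/-- **Deterministic linearization-error estimate.** If along the gradient flow for
`L(Θ) = ½‖f(Θ) − Y‖²` the empirical kernel `K̂(Θ(t)) = Df Dfᵀ` stays bounded below by
`λ` and within operator-norm distance `κ` of `K̂(Θ(0))`, then the trained model stays
within `(κR/λ)(1 − e^{−ηλt})` of the model trained with the linearized dynamics. -/
theorem linearization_error_bound {p n : ℕ}
    (f : EuclideanSpace ℝ (Fin p) → EuclideanSpace ℝ (Fin n)) (hf : ContDiff ℝ 1 f)
    (Y : EuclideanSpace ℝ (Fin n)) (η : ℝ) (hη : 0 < η)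
    (L : EuclideanSpace ℝ (Fin p) → ℝ)
    (hLdef : L = fun Θ => (1 / 2) * ‖f Θ - Y‖ ^ 2)
    (Θ : ℝ → EuclideanSpace ℝ (Fin p))
    (hΘ : ∀ t, 0 ≤ t → HasDerivAt Θ (-η • gradient L (Θ t)) t)
    (R : ℝ) (hR : R = ‖f (Θ 0) - Y‖)
    (Khat : EuclideanSpace ℝ (Fin p) → Matrix (Fin n) (Fin n) ℝ)
    (hKhat : ∀ Θ', Khat Θ' = jacobian f Θ' * (jacobian f Θ')ᵀ)
    (lam κ : ℝ) (hlam : 0 < lam) (hκ : 0 ≤ κ)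
    (hlower : ∀ t, 0 ≤ t → ∀ v : EuclideanSpace ℝ (Fin n),
      lam * ‖v‖ ^ 2 ≤ (fun i => v i) ⬝ᵥ (Khat (Θ t) *ᵥ fun i => v i))
    (hclose : ∀ t, 0 ≤ t → matOpNorm (Khat (Θ t) - Khat (Θ 0)) ≤ κ)
    (Flin : ℝ → EuclideanSpace ℝ (Fin n))
    (hFlin0 : Flin 0 = f (Θ 0))
    (hFlin : ∀ t, 0 ≤ t → HasDerivAt Flin
      (-η • (EuclideanSpace.equiv (Fin n) ℝ).symm (Khat (Θ 0) *ᵥ fun i => Flin t i - Y i)) t) :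
    ∀ t, 0 ≤ t → ‖f (Θ t) - Flin t‖ ≤ (κ * R / lam) * (1 - Real.exp (-η * lam * t)) := by
  have hR0 : 0 ≤ R := hR ▸ norm_nonneg _
  have hcoer : ∀ t, 0 ≤ t → ∀ v : EuclideanSpace ℝ (Fin n),
      lam * ‖v‖ ^ 2 ≤ ⟪v, Matrix.toEuclideanLin (Khat (Θ t)) v⟫_ℝ := fun t ht v =>
    (hlower t ht v).trans_eq (inner_toEuclideanLin _ v).symm
  have hmodel : ∀ t, 0 ≤ t → HasDerivAt (fun t => f (Θ t))
      (-η • Matrix.toEuclideanLin (Khat (Θ t)) (f (Θ t) - Y)) t := by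
    intro t ht
    have hfd : DifferentiableAt ℝ f (Θ t) := (hf.differentiable one_ne_zero) (Θ t)
    have hcomp := hfd.hasFDerivAt.comp_hasDerivAt t (hΘ t ht)
    rw [hLdef, (hasGradientAt_half_norm_sub_sq hfd Y).gradient, map_smul,
      ← toEuclideanLin_jacobian_mul_transpose, ← hKhat] at hcomp
    exact hcomp
  have hlin : ∀ t, 0 ≤ t → HasDerivAt Flin
      (-η • Matrix.toEuclideanLin (Khat (Θ 0)) (Flin t - Y)) t := hFlin
  have hresidual : ∀ t, 0 ≤ t → ‖f (Θ t) - Y‖ ≤ R * Real.exp (-(η * lam) * t) := by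
    intro t ht
    have h := norm_le_mul_exp_of_inner_deriv_le (c := η * lam) le_rfl
      (fun s hs => (hmodel s hs).sub_const Y) (fun s hs => ?_) ht
    · simpa [hR] using h
    · rw [real_inner_smul_right]
      nlinarith [mul_le_mul_of_nonneg_left (hcoer s hs (f (Θ s) - Y)) hη.le]
  intro t ht
  have herror := norm_le_mul_exp_of_inner_deriv_le (b := η * κ * R) (c := η * lam)
    (by positivity) (fun s hs => (hmodel s hs).sub (hlin s hs)) (fun s hs => ?_) ht
  · simp only [Pi.sub_apply, hFlin0, sub_self, norm_zero, zero_add] at herror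
    refine herror.trans ?_
    have hx : η * lam * t * Real.exp (-η * lam * t) ≤ 1 - Real.exp (-η * lam * t) := by
      have hcancel : Real.exp (η * lam * t) * Real.exp (-η * lam * t) = 1 := by
        rw [← Real.exp_add, ← Real.exp_zero]; congr 1; ring
      nlinarith [mul_le_mul_of_nonneg_right (Real.add_one_le_exp (η * lam * t))
        (Real.exp_pos (-η * lam * t)).le]
    calc η * κ * R * t * Real.exp (-(η * lam) * t)
        = κ * R / lam * (η * lam * t * Real.exp (-η * lam * t)) := by
          rw [← neg_mul]; field_simp
      _ ≤ _ := by gcongr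
  · simp only [Pi.sub_apply]
    set d := f (Θ s) - Flin s with hd
    set u := f (Θ s) - Y with hu
    have hsplit : -η • Matrix.toEuclideanLin (Khat (Θ s)) u -
        -η • Matrix.toEuclideanLin (Khat (Θ 0)) (Flin s - Y) =
        -η • (Matrix.toEuclideanLin (Khat (Θ 0)) d +
          Matrix.toEuclideanLin (Khat (Θ s) - Khat (Θ 0)) u) := by
      have hFlin_sub : Flin s - Y = u - d := by rw [hu, hd]; abel
      rw [hFlin_sub, map_sub _ u d, map_sub _ (Khat _), LinearMap.sub_apply]
      module
    have hperturb : ‖Matrix.toEuclideanLin (Khat (Θ s) - Khat (Θ 0)) u‖ ≤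
        κ * (R * Real.exp (-(η * lam) * s)) :=
      (norm_toEuclideanLin_le_matOpNorm _ _).trans
        (mul_le_mul (hclose s hs) (hresidual s hs) (norm_nonneg _) hκ)
    have hcross : -⟪d, Matrix.toEuclideanLin (Khat (Θ s) - Khat (Θ 0)) u⟫_ℝ ≤
        ‖d‖ * (κ * (R * Real.exp (-(η * lam) * s))) :=
      (neg_le_abs _).trans ((abs_real_inner_le_norm _ _).trans
        (mul_le_mul_of_nonneg_left hperturb (norm_nonneg _)))
    rw [hsplit, real_inner_smul_right, inner_add_right]
    linarith [mul_le_mul_of_nonneg_left (hcoer 0 le_rfl d) hη.le,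
      mul_le_mul_of_nonneg_left hcross hη.le]
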